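/- arXiv:0906.4901 — 4 statements merged into one kernel-verified Lean document; each statement's English description precedes it below -/
import Mathlib

section
/- Define ζ on sp(2,ℝ) = {A = [[a, b], [c, −a]] : a,b,c ∈ ℝ} (the trace-zero real 2×2 matrices) by: ζ(A) = √(−(a²+bc)) if a²+bc < 0, b < 0 and c > 0; ζ(A) = −√(−(a²+bc)) if a²+bc < 0, b > 0 and c < 0; and ζ(A) = 0 if a²+bc ≥ 0. Then ζ is a continuous Lie quasi-state on sp(2,ℝ) which is not linear. -/
open Matrix

/-- The Maslov quasi-state on `sp(2,ℝ)` (trace-zero real `2 × 2` matrices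
`A = [[a, b], [c, -a]]`): `√(-(a²+bc))` if `a²+bc < 0, b < 0, c > 0`;
`-√(-(a²+bc))` if `a²+bc < 0, b > 0, c < 0`; and `0` if `a²+bc ≥ 0`. -/
noncomputable def maslovZeta : Matrix (Fin 2) (Fin 2) ℝ → ℝ := fun A =>
  if (A 0 0) ^ 2 + A 0 1 * A 1 0 < 0 ∧ A 0 1 < 0 ∧ 0 < A 1 0 then
    Real.sqrt (-((A 0 0) ^ 2 + A 0 1 * A 1 0))
  else if (A 0 0) ^ 2 + A 0 1 * A 1 0 < 0 ∧ 0 < A 0 1 ∧ A 1 0 < 0 then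
    -Real.sqrt (-((A 0 0) ^ 2 + A 0 1 * A 1 0))
  else 0

theorem maslovZeta_eq_ite (A : Matrix (Fin 2) (Fin 2) ℝ) :
    maslovZeta A = if A 0 1 ≤ 0 then √(-((A 0 0) ^ 2 + A 0 1 * A 1 0))
      else -√(-((A 0 0) ^ 2 + A 0 1 * A 1 0)) := by
  unfold maslovZeta
  by_cases hq : (A 0 0) ^ 2 + A 0 1 * A 1 0 < 0
  · have hbc : A 0 1 * A 1 0 < 0 := by nlinarith [sq_nonneg (A 0 0)]
    rcases mul_neg_iff.mp hbc with ⟨hb, hc⟩ | ⟨hb, hc⟩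
    · simp [hq, hb, hc, hb.not_ge, hb.not_gt]
    · simp [hq, hb, hc, hb.le]
  · have h0 : √(-((A 0 0) ^ 2 + A 0 1 * A 1 0)) = 0 :=
      Real.sqrt_eq_zero_of_nonpos (by linarith)
    simp only [hq, h0, false_and, neg_zero, ite_self]

theorem continuous_maslovZeta : Continuous maslovZeta := by
  rw [funext maslovZeta_eq_ite]
  refine Continuous.if_le (by fun_prop) (by fun_prop) (by fun_prop) continuous_const ?_
  intro A hA
  have h0 : √(-((A 0 0) ^ 2 + A 0 1 * A 1 0)) = 0 :=
    Real.sqrt_eq_zero_of_nonpos (by rw [hA]; nlinarith [sq_nonneg (A 0 0)])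
  rw [h0, neg_zero]

theorem maslovZeta_smul (t : ℝ) (A : Matrix (Fin 2) (Fin 2) ℝ) :
    maslovZeta (t • A) = t * maslovZeta A := by
  have hs : √(-((t * A 0 0) ^ 2 + t * A 0 1 * (t * A 1 0))) =
      |t| * √(-((A 0 0) ^ 2 + A 0 1 * A 1 0)) := by
    rw [← Real.sqrt_sq_eq_abs, ← Real.sqrt_mul (sq_nonneg t)]
    congr 1
    ring
  rw [maslovZeta_eq_ite, maslovZeta_eq_ite]
  simp only [Matrix.smul_apply, smul_eq_mul, hs]
  rcases eq_or_ne (A 0 1) 0 with hb | hb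
  · have h0 : √(-((A 0 0) ^ 2 + A 0 1 * A 1 0)) = 0 :=
      Real.sqrt_eq_zero_of_nonpos (by rw [hb]; nlinarith [sq_nonneg (A 0 0)])
    simp only [h0, mul_zero, neg_zero, ite_self]
  rcases lt_trichotomy t 0 with ht | rfl | ht
  · rcases lt_or_gt_of_ne hb with hb | hb
    · rw [if_neg (mul_pos_of_neg_of_neg ht hb).not_ge, if_pos hb.le, abs_of_neg ht]
      ring
    · rw [if_pos (mul_neg_of_neg_of_pos ht hb).le, if_neg hb.not_ge, abs_of_neg ht]
      ring
  · simp
  · rcases lt_or_gt_of_ne hb with hb | hb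
    · rw [if_pos (mul_neg_of_pos_of_neg ht hb).le, if_pos hb.le, abs_of_pos ht]
    · rw [if_neg (mul_pos ht hb).not_ge, if_neg hb.not_ge, abs_of_pos ht]
      ring

/-- A trace-zero real `2 × 2` matrix commuting with a nonzero trace-zero one is a multiple of it. -/
theorem exists_eq_smul_of_commute_of_trace_eq_zero {A B : Matrix (Fin 2) (Fin 2) ℝ}
    (hA : A.trace = 0) (hB : B.trace = 0) (hAB : A * B = B * A) (h0 : A ≠ 0) :
    ∃ t : ℝ, B = t • A := by
  rw [Matrix.trace_fin_two] at hA hB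
  have hA' : A 1 1 = -A 0 0 := by linarith
  have hB' : B 1 1 = -B 0 0 := by linarith
  have e00 := congrFun₂ hAB 0 0
  have e01 := congrFun₂ hAB 0 1
  have e10 := congrFun₂ hAB 1 0
  simp only [Matrix.mul_apply, Fin.sum_univ_two, hA', hB'] at e00 e01 e10
  have key : ∀ t : ℝ, B 0 0 = t * A 0 0 → B 0 1 = t * A 0 1 → B 1 0 = t * A 1 0 →
      B = t • A := by
    intro t h1 h2 h3
    ext i j
    fin_cases i <;> fin_cases j <;> simp [h1, h2, h3, hA', hB']
  by_cases ha : A 0 0 = 0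
  · by_cases hb : A 0 1 = 0
    · have hc : A 1 0 ≠ 0 := by
        intro hc
        apply h0
        ext i j
        fin_cases i <;> fin_cases j <;> simp [ha, hb, hc, hA']
      refine ⟨B 1 0 / A 1 0, key _ ?_ ?_ ?_⟩ <;> field_simp <;> linarith
    · refine ⟨B 0 1 / A 0 1, key _ ?_ ?_ ?_⟩ <;> field_simp <;> linarith
  · refine ⟨B 0 0 / A 0 0, key _ ?_ ?_ ?_⟩ <;> field_simp <;> linarith

/-- The above `ζ` is a continuous Lie quasi-state on `sp(2,ℝ)` which is not linear. -/
theorem stmt4 :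
    (∀ A B : Matrix (Fin 2) (Fin 2) ℝ, A.trace = 0 → B.trace = 0 → A * B = B * A →
      ∀ c₁ c₂ : ℝ, maslovZeta (c₁ • A + c₂ • B) = c₁ * maslovZeta A + c₂ * maslovZeta B) ∧
    ContinuousOn maslovZeta {A : Matrix (Fin 2) (Fin 2) ℝ | A.trace = 0} ∧
    ¬ ∃ l : Matrix (Fin 2) (Fin 2) ℝ →ₗ[ℝ] ℝ,
        ∀ A : Matrix (Fin 2) (Fin 2) ℝ, A.trace = 0 → maslovZeta A = l A := by
  refine ⟨?_, continuous_maslovZeta.continuousOn, ?_⟩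
  · intro A B hA hB hAB c₁ c₂
    by_cases h0 : A = 0
    · have hz : maslovZeta 0 = 0 := by simpa using maslovZeta_smul 0 0
      simp [h0, hz, maslovZeta_smul]
    · obtain ⟨t, rfl⟩ := exists_eq_smul_of_commute_of_trace_eq_zero hA hB hAB h0
      rw [smul_smul, ← add_smul, maslovZeta_smul, maslovZeta_smul]
      ring
  · rintro ⟨l, hl⟩
    have hE := hl !![0, 1; 0, 0] (by simp [Matrix.trace_fin_two])
    have hF := hl !![0, 0; -1, 0] (by simp [Matrix.trace_fin_two])
    have hEF := hl (!![0, 1; 0, 0] + !![0, 0; -1, 0]) (by simp [Matrix.trace_fin_two])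
    rw [map_add, ← hE, ← hF] at hEF
    norm_num [maslovZeta] at hEF
end

section
/- Every odd homogeneous function on sp(2,ℝ) is a Lie quasi-state: if ζ: sp(2,ℝ) → ℝ satisfies ζ(cA) = c·ζ(A) for every c ∈ ℝ and every A ∈ sp(2,ℝ), then ζ is quasi-linear, i.e., [A,B] = 0 implies ζ(c₁A + c₂B) = c₁ζ(A) + c₂ζ(B) for all c₁,c₂ ∈ ℝ. -/
open Matrix

/-- In trace-zero `2 × 2` matrices over a field of characteristic not two, the centralizer of a
nonzero element is the line it spans. -/
theorem Matrix.eq_zero_or_exists_eq_smul_of_commute_of_trace_eq_zero {K : Type*} [Field K]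
    (h2 : (2 : K) ≠ 0) {A B : Matrix (Fin 2) (Fin 2) K} (hA : A.trace = 0) (hB : B.trace = 0)
    (h : Commute A B) : A = 0 ∨ ∃ t : K, B = t • A := by
  rw [Matrix.trace_fin_two] at hA hB
  have hA' : A 1 1 = -A 0 0 := by linear_combination hA
  have hB' : B 1 1 = -B 0 0 := by linear_combination hB
  have h00 := congrFun (congrFun h.eq 0) 0
  have h01 := congrFun (congrFun h.eq 0) 1
  have h10 := congrFun (congrFun h.eq 1) 0
  simp only [Matrix.mul_apply, Fin.sum_univ_two, hA', hB'] at h00 h01 h10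
  have e1 : A 0 1 * B 1 0 = B 0 1 * A 1 0 := by linear_combination h00
  have e2 : A 0 0 * B 0 1 = B 0 0 * A 0 1 :=
    mul_left_cancel₀ h2 (by linear_combination h01)
  have e3 : A 0 0 * B 1 0 = B 0 0 * A 1 0 :=
    mul_left_cancel₀ h2 (by linear_combination -h10)
  by_cases a : A 0 0 = 0
  · by_cases b : A 0 1 = 0
    · by_cases c : A 1 0 = 0
      · left
        ext i j
        fin_cases i <;> fin_cases j <;> simp [a, b, c, hA']
      · refine Or.inr ⟨B 1 0 / A 1 0, ?_⟩
        ext i j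
        fin_cases i <;> fin_cases j <;> simp [hA', hB'] <;> field_simp <;> grind
    · refine Or.inr ⟨B 0 1 / A 0 1, ?_⟩
      ext i j
      fin_cases i <;> fin_cases j <;> simp [hA', hB'] <;> field_simp <;> grind
  · refine Or.inr ⟨B 0 0 / A 0 0, ?_⟩
    ext i j
    fin_cases i <;> fin_cases j <;> simp [hA', hB'] <;> field_simp <;> grind

/-- Every odd homogeneous function on `sp(2,ℝ)` (trace-zero real `2 × 2` matrices) is a Lie
quasi-state: if `ζ (c • A) = c * ζ A` for all `c ∈ ℝ` and all `A ∈ sp(2,ℝ)`, then `ζ` is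
quasi-linear on `sp(2,ℝ)`. -/
theorem stmt6 (ζ : Matrix (Fin 2) (Fin 2) ℝ → ℝ)
    (hhom : ∀ (c : ℝ) (A : Matrix (Fin 2) (Fin 2) ℝ), A.trace = 0 → ζ (c • A) = c * ζ A) :
    ∀ A B : Matrix (Fin 2) (Fin 2) ℝ, A.trace = 0 → B.trace = 0 → A * B = B * A →
      ∀ c₁ c₂ : ℝ, ζ (c₁ • A + c₂ • B) = c₁ * ζ A + c₂ * ζ B := by
  intro A B hA hB hAB c₁ c₂
  have hζ0 : ζ 0 = 0 := by simpa using hhom 0 0 (by simp)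
  rcases Matrix.eq_zero_or_exists_eq_smul_of_commute_of_trace_eq_zero two_ne_zero hA hB hAB with
    rfl | ⟨t, rfl⟩
  · simp [hζ0, hhom c₂ B hB]
  · rw [smul_smul, ← add_smul, hhom _ A hA, hhom _ A hA]
    ring
end

section
/- Let n ≥ 3 and let ζ be a continuous Lie quasi-state on the Lie algebra gl(n,ℝ) of all real n×n matrices (with the commutator bracket). Then there exists a real n×n matrix N such that ζ(A) = tr(NA) for every A ∈ gl(n,ℝ) of rank 1. -/
open Matrix

theorem exists_ne_zero_dotProduct_eq_zero_and {ι : Type*} [Fintype ι]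
    (hι : 3 ≤ Fintype.card ι) (ξ η : ι → ℝ) :
    ∃ w : ι → ℝ, w ≠ 0 ∧ ξ ⬝ᵥ w = 0 ∧ η ⬝ᵥ w = 0 := by
  have hker := LinearMap.ker_ne_bot_of_finrank_lt (f := (of ![ξ, η]).mulVecLin)
    (by simp; omega)
  obtain ⟨w, hw, hw0⟩ := Submodule.exists_mem_ne_zero_of_ne_bot hker
  rw [LinearMap.mem_ker, mulVecLin_apply] at hw
  exact ⟨w, hw0, by simpa [mulVec] using congrFun hw 0, by simpa [mulVec] using congrFun hw 1⟩

/-- Lie quasi-states on the Lie algebra of all real square matrices indexed by `ι`. -/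
def IsLieQuasiState {ι : Type*} [Fintype ι] (ζ : Matrix ι ι ℝ → ℝ) : Prop :=
  ∀ A B : Matrix ι ι ℝ, ⁅A, B⁆ = 0 →
    ∀ c₁ c₂ : ℝ, ζ (c₁ • A + c₂ • B) = c₁ * ζ A + c₂ * ζ B

namespace IsLieQuasiState

variable {ι : Type*} [Fintype ι] {ζ : Matrix ι ι ℝ → ℝ}

theorem map_smul (h : IsLieQuasiState ζ) (c : ℝ) (A : Matrix ι ι ℝ) : ζ (c • A) = c * ζ A := by
  simpa using h A A (by rw [Ring.lie_def, sub_self]) c 0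

theorem map_smul_vecMulVec (h : IsLieQuasiState ζ) (c : ℝ) (x ξ : ι → ℝ) :
    ζ (vecMulVec (c • x) ξ) = c * ζ (vecMulVec x ξ) := by
  rw [smul_vecMulVec, h.map_smul]

theorem transpose (h : IsLieQuasiState ζ) : IsLieQuasiState fun A => ζ Aᵀ := by
  intro A B hAB c₁ c₂
  have hAB' : ⁅Aᵀ, Bᵀ⁆ = 0 := by
    rw [Ring.lie_def, sub_eq_zero] at hAB ⊢
    rw [← transpose_mul, ← transpose_mul, hAB]
  simpa using h Aᵀ Bᵀ hAB' c₁ c₂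

theorem map_vecMulVec_add_vecMulVec (h : IsLieQuasiState ζ) {x ξ y η : ι → ℝ}
    (h₁ : ξ ⬝ᵥ y = 0) (h₂ : η ⬝ᵥ x = 0) :
    ζ (vecMulVec x ξ + vecMulVec y η) = ζ (vecMulVec x ξ) + ζ (vecMulVec y η) := by
  have hcomm : ⁅vecMulVec x ξ, vecMulVec y η⁆ = 0 := by
    rw [Ring.lie_def, vecMulVec_mul_vecMulVec, vecMulVec_mul_vecMulVec, h₁, h₂]
    simp
  simpa using h _ _ hcomm 1 1

/-- Two decompositions of the same rank two matrix into commuting rank one matrices. -/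
theorem exchange (h : IsLieQuasiState ζ) {p z ξ η : ι → ℝ}
    (hξp : ξ ⬝ᵥ p = 1) (hξz : ξ ⬝ᵥ z = 0) (hηp : η ⬝ᵥ p = 0) (hηz : η ⬝ᵥ z = 1) :
    ζ (vecMulVec (p + z) ξ) - ζ (vecMulVec p ξ) =
      ζ (vecMulVec z η) - ζ (vecMulVec z (η - ξ)) := by
  have e₁ := h.map_vecMulVec_add_vecMulVec hξz hηp
  have e₂ := h.map_vecMulVec_add_vecMulVec (x := p + z) (η := η - ξ) hξz
    (by simp [sub_dotProduct, dotProduct_add, hξp, hξz, hηp, hηz])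
  have e₃ : vecMulVec (p + z) ξ + vecMulVec z (η - ξ) = vecMulVec p ξ + vecMulVec z η := by
    rw [add_vecMulVec, vecMulVec_sub]; abel
  rw [e₃] at e₂
  linarith

/-- The increment of `ζ` along a direction tangent to `ξ = 1` is constant on lines. -/
theorem increment_eq (h : IsLieQuasiState ζ) (hι : 3 ≤ Fintype.card ι) {p z ξ : ι → ℝ}
    (hξp : ξ ⬝ᵥ p = 1) (hξz : ξ ⬝ᵥ z = 0) (k : ℝ) :
    ζ (vecMulVec (p + k • z + z) ξ) - ζ (vecMulVec (p + k • z) ξ) =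
      ζ (vecMulVec (p + z) ξ) - ζ (vecMulVec p ξ) := by
  rcases eq_or_ne z 0 with rfl | hz
  · simp
  have hzz : z ⬝ᵥ z ≠ 0 := by rwa [Ne, dotProduct_self_eq_zero]
  obtain ⟨η, hηp, hηz⟩ : ∃ η : ι → ℝ, η ⬝ᵥ p = 0 ∧ η ⬝ᵥ z = 1 := by
    refine ⟨(z ⬝ᵥ z)⁻¹ • (z - (z ⬝ᵥ p) • ξ), ?_, ?_⟩
    · simp [sub_dotProduct, hξp]
    · simp [sub_dotProduct, hξz, hzz]
  obtain ⟨w, hw, hξw, hηw⟩ := exists_ne_zero_dotProduct_eq_zero_and hι ξ η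
  have hww : w ⬝ᵥ w ≠ 0 := by rwa [Ne, dotProduct_self_eq_zero]
  obtain ⟨θ, hθp, hθz, hθw⟩ : ∃ θ : ι → ℝ, θ ⬝ᵥ p = 0 ∧ θ ⬝ᵥ z = 0 ∧ θ ⬝ᵥ w = 1 := by
    refine ⟨(w ⬝ᵥ w)⁻¹ • (w - (w ⬝ᵥ p) • ξ - (w ⬝ᵥ z) • η), ?_, ?_, ?_⟩
    · simp [sub_dotProduct, hξp, hηp]
    · simp [sub_dotProduct, hξz, hηz]
    · simp [sub_dotProduct, hξw, hηw, hww]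
  have e₁ := h.exchange hξp hξz hηp hηz
  have e₂ := h.exchange (p := p + w) (by simp [dotProduct_add, hξp, hξw]) hξz
    (by simp [dotProduct_add, hηp, hηw]) hηz
  have e₃ := h.exchange (p := p + w) (η := η - k • ξ + k • θ)
    (by simp [dotProduct_add, hξp, hξw]) hξz
    (by simp [dotProduct_add, add_dotProduct, sub_dotProduct, *])
    (by simp [add_dotProduct, sub_dotProduct, *])
  have e₄ := h.exchange (p := p + k • z) (η := η - k • ξ + k • θ)
    (by simp [dotProduct_add, *]) hξz
    (by simp [dotProduct_add, add_dotProduct, sub_dotProduct, *])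
    (by simp [add_dotProduct, sub_dotProduct, *])
  linarith

theorem map_add_nsmul (h : IsLieQuasiState ζ) (hι : 3 ≤ Fintype.card ι) {p z ξ : ι → ℝ}
    (hξp : ξ ⬝ᵥ p = 1) (hξz : ξ ⬝ᵥ z = 0) (k : ℕ) :
    ζ (vecMulVec (p + (k : ℝ) • z) ξ) =
      ζ (vecMulVec p ξ) + k * (ζ (vecMulVec (p + z) ξ) - ζ (vecMulVec p ξ)) := by
  induction k with
  | zero => simp
  | succ k ih =>
    have e := h.increment_eq hι hξp hξz k
    have e' : p + (k : ℝ) • z + z = p + ((k : ℝ) + 1) • z := by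
      rw [add_smul, one_smul, add_assoc]
    rw [e'] at e
    push_cast
    linarith

theorem map_add_of_dotProduct_eq_one (h : IsLieQuasiState ζ) (hc : Continuous ζ)
    (hι : 3 ≤ Fintype.card ι) {p z ξ : ι → ℝ} (hξp : ξ ⬝ᵥ p = 1) (hξz : ξ ⬝ᵥ z = 0) :
    ζ (vecMulVec (p + z) ξ) = ζ (vecMulVec p ξ) + ζ (vecMulVec z ξ) := by
  have hF : Continuous fun t : ℝ => ζ (vecMulVec (t • p + z) ξ) - t * ζ (vecMulVec p ξ) := by
    fun_prop
  have hlim := (hF.tendsto 0).comp (tendsto_one_div_add_atTop_nhds_zero_nat (𝕜 := ℝ))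
  have hconst : ((fun t : ℝ => ζ (vecMulVec (t • p + z) ξ) - t * ζ (vecMulVec p ξ)) ∘
      fun k : ℕ => 1 / ((k : ℝ) + 1)) =
      fun _ => ζ (vecMulVec (p + z) ξ) - ζ (vecMulVec p ξ) := by
    funext k
    have hk : (k : ℝ) + 1 ≠ 0 := by positivity
    have e := h.map_add_nsmul hι hξp hξz (k + 1)
    have e' : (1 / ((k : ℝ) + 1)) • p + z =
        (1 / ((k : ℝ) + 1)) • (p + ((k + 1 : ℕ) : ℝ) • z) := by
      rw [smul_add, smul_smul]
      push_cast
      rw [one_div_mul_cancel hk, one_smul]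
    simp only [Function.comp]
    rw [e', h.map_smul_vecMulVec, e]
    push_cast
    field_simp
    ring
  rw [hconst] at hlim
  have := tendsto_nhds_unique hlim tendsto_const_nhds
  simp only [zero_smul, zero_add, zero_mul, sub_zero] at this
  linarith

theorem map_add_of_dotProduct_eq_zero (h : IsLieQuasiState ζ) (hc : Continuous ζ)
    (hι : 3 ≤ Fintype.card ι) {x z ξ : ι → ℝ} (hξz : ξ ⬝ᵥ z = 0) :
    ζ (vecMulVec (x + z) ξ) = ζ (vecMulVec x ξ) + ζ (vecMulVec z ξ) := by
  by_cases hx : ξ ⬝ᵥ x = 0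
  · rw [add_vecMulVec, h.map_vecMulVec_add_vecMulVec hξz hx]
  have e := h.map_add_of_dotProduct_eq_one hc hι (p := (ξ ⬝ᵥ x)⁻¹ • x) (z := (ξ ⬝ᵥ x)⁻¹ • z)
    (ξ := ξ) (by simp [hx]) (by simp [hξz])
  rw [← smul_add, h.map_smul_vecMulVec, h.map_smul_vecMulVec, h.map_smul_vecMulVec,
    ← mul_add] at e
  exact mul_left_cancel₀ (inv_ne_zero hx) e

theorem map_add_vecMulVec (h : IsLieQuasiState ζ) (hc : Continuous ζ)
    (hι : 3 ≤ Fintype.card ι) (x y ξ : ι → ℝ) :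
    ζ (vecMulVec (x + y) ξ) = ζ (vecMulVec x ξ) + ζ (vecMulVec y ξ) := by
  by_cases hx : ξ ⬝ᵥ x = 0
  · rw [add_comm x, h.map_add_of_dotProduct_eq_zero hc hι hx, add_comm]
  obtain ⟨c, z, hz, rfl⟩ : ∃ (c : ℝ) (z : ι → ℝ), ξ ⬝ᵥ z = 0 ∧ y = c • x + z :=
    ⟨(ξ ⬝ᵥ y) / (ξ ⬝ᵥ x), y - ((ξ ⬝ᵥ y) / (ξ ⬝ᵥ x)) • x, by simp [dotProduct_sub, hx], by simp⟩
  have e : x + (c • x + z) = (1 + c) • x + z := by rw [add_smul, one_smul, add_assoc]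
  rw [e, h.map_add_of_dotProduct_eq_zero hc hι hz, h.map_add_of_dotProduct_eq_zero hc hι hz,
    h.map_smul_vecMulVec, h.map_smul_vecMulVec]
  ring

/-- A continuous Lie quasi-state is bilinear on rank one matrices. -/
theorem exists_bilinear (h : IsLieQuasiState ζ) (hc : Continuous ζ)
    (hι : 3 ≤ Fintype.card ι) :
    ∃ B : (ι → ℝ) →ₗ[ℝ] (ι → ℝ) →ₗ[ℝ] ℝ, ∀ x ξ, B x ξ = ζ (vecMulVec x ξ) := by
  refine ⟨LinearMap.mk₂ ℝ (fun x ξ => ζ (vecMulVec x ξ)) (fun x y ξ => ?_) (fun c x ξ => ?_)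
    (fun x ξ η => ?_) (fun c x ξ => ?_), fun x ξ => rfl⟩
  · exact h.map_add_vecMulVec hc hι x y ξ
  · exact h.map_smul_vecMulVec c x ξ
  · have e := h.transpose.map_add_vecMulVec (by fun_prop) hι ξ η x
    simpa only [transpose_vecMulVec] using e
  · rw [vecMulVec_smul, h.map_smul, smul_eq_mul]

end IsLieQuasiState

theorem Matrix.exists_eq_vecMulVec_of_rank_eq_one {m n K : Type*} [Fintype n] [Field K]
    {A : Matrix m n K} (hA : A.rank = 1) :
    ∃ (x : m → K) (ξ : n → K), A = vecMulVec x ξ := by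
  classical
  obtain ⟨v, -, hv⟩ := finrank_eq_one_iff'.mp hA
  choose c hcv using fun j => hv ⟨A.mulVecLin (Pi.single j 1), LinearMap.mem_range_self _ _⟩
  refine ⟨v, c, ?_⟩
  ext i j
  have := congrFun (congrArg Subtype.val (hcv j)) i
  simp only [SetLike.val_smul, Pi.smul_apply, smul_eq_mul, mulVecLin_apply,
    mulVec_single_one, col_apply] at this
  rw [vecMulVec_apply, ← this, mul_comm]

/-- Let `n ≥ 3` and let `ζ` be a continuous Lie quasi-state on `gl(n,ℝ)` (all real `n × n`
matrices with the commutator bracket).  Then there is a matrix `N` with `ζ(A) = tr (N * A)`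
for every matrix `A` of rank `1`. -/
theorem stmt16 (n : ℕ) (hn : 3 ≤ n)
    (ζ : Matrix (Fin n) (Fin n) ℝ → ℝ)
    (hq : ∀ A B : Matrix (Fin n) (Fin n) ℝ, ⁅A, B⁆ = 0 →
      ∀ c₁ c₂ : ℝ, ζ (c₁ • A + c₂ • B) = c₁ * ζ A + c₂ * ζ B)
    (hc : Continuous ζ) :
    ∃ N : Matrix (Fin n) (Fin n) ℝ,
      ∀ A : Matrix (Fin n) (Fin n) ℝ, A.rank = 1 → ζ A = (N * A).trace := by
  obtain ⟨B, hB⟩ := IsLieQuasiState.exists_bilinear (ζ := ζ) hq hc (by simpa using hn)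
  refine ⟨(LinearMap.toMatrix₂' ℝ B)ᵀ, fun A hA => ?_⟩
  obtain ⟨x, ξ, rfl⟩ := exists_eq_vecMulVec_of_rank_eq_one hA
  rw [← hB, mul_vecMulVec, trace_vecMulVec, mulVec_transpose, ← dotProduct_mulVec,
    ← Matrix.toLinearMap₂'_apply', Matrix.toLinearMap₂'_toMatrix']
end

section
/- Let A be a real 2n×2n matrix with A^{2n} = 0 (e.g., a matrix whose Jordan form is a single nilpotent Jordan block of size 2n), and let v = A + a₃A³ + a₅A⁵ + ⋯ + a_{2n−1}A^{2n−1} for some a₃, a₅, …, a_{2n−1} ∈ ℝ. If a real 2n×2n matrix x satisfies [x,v] = 0, then [x, A^{2m−1}] = 0 for every m = 1, …, n; in particular x commutes with A. -/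
open Matrix

/-- If `A` is nilpotent, then `A` lies in every subalgebra that contains a polynomial in `A`
of the form `A + (higher order terms)`. -/
theorem mem_of_aeval_mem_of_pow_eq_zero {K R : Type*} [CommRing K] [Ring R] [Algebra K R]
    (S : Subalgebra K R) {A : R} {N : ℕ} (hA : A ^ N = 0) (q : Polynomial K)
    (hq : Polynomial.aeval A (Polynomial.X * (1 + Polynomial.X * q)) ∈ S) : A ∈ S := by
  have key : ∀ j ≤ N, ∀ p : Polynomial K,
      Polynomial.aeval A (Polynomial.X ^ (N - j) * p) ∈ S := by
    intro j
    induction j with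
    | zero => intro _ p; simp [hA]
    | succ j ih =>
      intro hj p
      obtain ⟨k, hk⟩ : ∃ k, k = N - (j + 1) := ⟨_, rfl⟩
      have hk' : N - j = k + 1 := by omega
      rw [← hk]
      have ih := ih (by omega)
      rw [hk'] at ih
      obtain ⟨r, hr⟩ : Polynomial.X ∣ (1 + Polynomial.X * q) ^ k - 1 := by
        refine Dvd.dvd.trans ⟨q, ?_⟩ (sub_one_dvd_pow_sub_one (1 + Polynomial.X * q) k)
        ring
      have hsplit : Polynomial.X ^ k * p =
          Polynomial.C (p.coeff 0) * (Polynomial.X * (1 + Polynomial.X * q)) ^ k +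
            Polynomial.X ^ (k + 1) * (p.divX - Polynomial.C (p.coeff 0) * r) := by
        rw [mul_pow, sub_eq_iff_eq_add.mp hr]
        nth_rewrite 1 [← Polynomial.divX_mul_X_add p]
        ring
      rw [hsplit, map_add, map_mul, map_pow, Polynomial.aeval_C]
      exact S.add_mem (S.mul_mem (S.algebraMap_mem _) (S.pow_mem hq k)) (ih _)
  simpa using key N le_rfl Polynomial.X

/-- Let `A` be a real `2n × 2n` matrix with `A^{2n} = 0` and let
`v = A + a₃A³ + a₅A⁵ + ⋯ + a_{2n-1}A^{2n-1}`.  If `x` commutes with `v`, then `x` commutes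
with `A^{2m-1}` for every `m = 1, …, n`; in particular `x` commutes with `A`. -/
theorem stmt19 (n : ℕ)
    (A : Matrix (Fin (2 * n)) (Fin (2 * n)) ℝ) (hA : A ^ (2 * n) = 0)
    (a : ℕ → ℝ)
    (x v : Matrix (Fin (2 * n)) (Fin (2 * n)) ℝ)
    (hv : v = A + ∑ i ∈ Finset.Icc 2 n, a i • A ^ (2 * i - 1))
    (hxv : x * v = v * x) :
    (∀ m : ℕ, 1 ≤ m → m ≤ n → x * A ^ (2 * m - 1) = A ^ (2 * m - 1) * x) ∧
    x * A = A * x := by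
  have hmem : A ∈ Subalgebra.centralizer ℝ {x} := by
    refine mem_of_aeval_mem_of_pow_eq_zero _ hA
      (∑ i ∈ Finset.Icc 2 n, a i • Polynomial.X ^ (2 * i - 3)) ?_
    have hva : Polynomial.aeval A (Polynomial.X * (1 + Polynomial.X *
        ∑ i ∈ Finset.Icc 2 n, a i • (Polynomial.X : Polynomial ℝ) ^ (2 * i - 3))) = v := by
      simp only [hv, map_add, map_sum, map_smul, map_pow, Polynomial.aeval_X,
        mul_add, mul_one, Finset.mul_sum, mul_smul_comm, ← pow_succ']
      congr 1
      refine Finset.sum_congr rfl fun i hi => ?_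
      have := (Finset.mem_Icc.mp hi).1
      congr 2
      omega
    rw [hva]
    simpa [Subalgebra.mem_centralizer_iff] using hxv
  have hxA : Commute x A := by
    simpa [commute_iff_eq, Subalgebra.mem_centralizer_iff] using hmem
  exact ⟨fun m _ _ => hxA.pow_right _, hxA⟩
end
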